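/- arXiv:1911.01332 — 5 statements merged into one kernel-verified Lean document; each statement's English description precedes it below -/
import Mathlib

section
/- Let (E,d,h₁,…,hₙ) be a K(B,f̲)-dg module. The degreewise B-linear map φ : (E,d)⊗_B K(B,f̲) → E defined on the degree-m component by x ⊗ ε_{i₁}∧⋯∧ε_{i_k} ↦ h_{i₁}∘⋯∘h_{i_k}(x) for x ∈ E_{m+k} (and x ⊗ 1 ↦ x for k = 0) is a morphism of K(B,f̲)-dg modules: it satisfies φ∘∂ = d∘φ and φ∘ηʲ = h_j∘φ for every j = 1,…,n. -/
open TensorProduct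

/-- The exterior algebra of a finite free module is spanned by products of basis vectors. -/
theorem ExteriorAlgebra.span_list_prod_single_eq_top (B : Type*) [CommRing B] (n : ℕ) :
    Submodule.span B (Set.range fun l : List (Fin n) =>
      (l.map fun i => ExteriorAlgebra.ι B (Pi.single i (1 : B) : Fin n → B)).prod) = ⊤ := by
  set S := Submodule.span B (Set.range fun l : List (Fin n) =>
      (l.map fun i => ExteriorAlgebra.ι B (Pi.single i (1 : B) : Fin n → B)).prod) with hS
  have key : ∀ (i : Fin n) (ω : ExteriorAlgebra B (Fin n → B)), ω ∈ S →
      ExteriorAlgebra.ι B (Pi.single i (1 : B)) * ω ∈ S := by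
    intro i ω hω
    induction hω using Submodule.span_induction with
    | mem y hy =>
      obtain ⟨l, rfl⟩ := hy
      exact Submodule.subset_span ⟨i :: l, by simp⟩
    | zero => simp
    | add y z _ _ hy hz => rw [mul_add]; exact S.add_mem hy hz
    | smul b y _ hy => rw [mul_smul_comm]; exact S.smul_mem b hy
  rw [eq_top_iff]
  rintro ω -
  induction ω using CliffordAlgebra.left_induction with
  | algebraMap r =>
    rw [Algebra.algebraMap_eq_smul_one]
    exact S.smul_mem r (Submodule.subset_span ⟨[], by simp⟩)
  | add y z hy hz => exact S.add_mem hy hz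
  | ι_mul y v hy =>
    change ExteriorAlgebra.ι B v * y ∈ S
    rw [pi_eq_sum_univ' v, map_sum, Finset.sum_mul]
    refine S.sum_mem fun i _ => ?_
    rw [map_smul, smul_mul_assoc]
    exact S.smul_mem _ (key i y hy)

/-- Linear maps out of `M ⊗ Λ(Bⁿ)` agreeing on `x ⊗ (ε_{i₁} ∧ ⋯ ∧ ε_{i_k})` are equal. -/
theorem ExteriorAlgebra.tensor_hom_ext {B M N : Type*} [CommRing B] [AddCommGroup M] [Module B M]
    [AddCommGroup N] [Module B N] {n : ℕ}
    {p q : (M ⊗[B] ExteriorAlgebra B (Fin n → B)) →ₗ[B] N}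
    (hpq : ∀ (l : List (Fin n)) (x : M),
      p (x ⊗ₜ[B] (l.map fun i => ExteriorAlgebra.ι B (Pi.single i (1 : B))).prod) =
        q (x ⊗ₜ[B] (l.map fun i => ExteriorAlgebra.ι B (Pi.single i (1 : B))).prod)) :
    p = q := by
  refine TensorProduct.ext (LinearMap.ext fun x => ?_)
  refine LinearMap.ext_on_range (ExteriorAlgebra.span_list_prod_single_eq_top B n) fun l => ?_
  exact hpq l x

/-- Commuting `d` past a product of homotopies `h i` with `d h + h d = f`. -/
theorem Module.End.mul_list_prod_homotopy {B M I : Type*} [CommRing B] [AddCommGroup M]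
    [Module B M] (f : I → B) (d : Module.End B M) (h : I → Module.End B M)
    (hdh : ∀ i, d * h i + h i * d = f i • (1 : Module.End B M)) (l : List I) :
    d * (l.map h).prod = ((-1 : B) ^ l.length) • ((l.map h).prod * d) +
      ∑ j : Fin l.length, ((-1 : B) ^ (j : ℕ) * f (l.get j)) •
        ((l.eraseIdx j).map h).prod := by
  induction l with
  | nil => simp
  | cons i l ih =>
    have hi : d * h i = f i • (1 : Module.End B M) - h i * d := eq_sub_of_add_eq (hdh i)
    simp only [List.length_cons, Fin.sum_univ_succ, List.map_cons, List.prod_cons]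
    rw [← mul_assoc, hi, sub_mul, mul_assoc, ih, mul_add, Finset.mul_sum]
    simp [pow_succ, mul_assoc, sub_eq_add_neg]
    abel

/-- Let `(E, d, h₁, …, hₙ)` be a `K(B,f̲)`-dg module (presented through
its total module `M`).  The map `φ : (E,d) ⊗_B K(B,f̲) → E` defined on generators by
`x ⊗ ε_{i₁}∧⋯∧ε_{i_k} ↦ (h_{i₁}∘⋯∘h_{i_k})(x)` (and `x ⊗ 1 ↦ x` for `k = 0`) is a
morphism of `K(B,f̲)`-dg modules: `φ∘∂ = d∘φ` and `φ∘ηʲ = h_j∘φ` for every `j`. -/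
theorem canonical_map_from_tensor_is_morphism
    {B M : Type*} [CommRing B] [AddCommGroup M] [Module B M]
    {n : ℕ} (f : Fin n → B)
    (d : Module.End B M) (h : Fin n → Module.End B M)
    (hd : d * d = 0)
    (hhsq : ∀ i, h i * h i = 0)
    (hdh : ∀ i, d * h i + h i * d = f i • (1 : Module.End B M))
    (hhh : ∀ i j, h i * h j + h j * h i = 0)
    (del : Module.End B (M ⊗[B] ExteriorAlgebra B (Fin n → B)))
    (eta : Fin n → Module.End B (M ⊗[B] ExteriorAlgebra B (Fin n → B)))
    (hdel : ∀ (k : ℕ) (ι : Fin k → Fin n) (x : M),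
      del (x ⊗ₜ[B] (List.ofFn fun j => ExteriorAlgebra.ι B (Pi.single (ι j) (1 : B))).prod) =
        ((-1 : B) ^ k) •
          (d x ⊗ₜ[B] (List.ofFn fun j => ExteriorAlgebra.ι B (Pi.single (ι j) (1 : B))).prod)
        + ∑ j : Fin k, ((-1 : B) ^ (j : ℕ) * f (ι j)) •
            (x ⊗ₜ[B]
              ((List.ofFn fun l =>
                ExteriorAlgebra.ι B (Pi.single (ι l) (1 : B))).eraseIdx (j : ℕ)).prod))
    (heta : ∀ (j : Fin n) (x : M) (ω : ExteriorAlgebra B (Fin n → B)),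
      eta j (x ⊗ₜ[B] ω) = x ⊗ₜ[B] (ExteriorAlgebra.ι B (Pi.single j (1 : B)) * ω))
    (φ : (M ⊗[B] ExteriorAlgebra B (Fin n → B)) →ₗ[B] M)
    (hφ : ∀ (k : ℕ) (ι : Fin k → Fin n) (x : M),
      φ (x ⊗ₜ[B] (List.ofFn fun j => ExteriorAlgebra.ι B (Pi.single (ι j) (1 : B))).prod) =
        (List.ofFn fun j => h (ι j)).prod x) :
    φ.comp (del : (M ⊗[B] ExteriorAlgebra B (Fin n → B)) →ₗ[B] _) =
      (d : M →ₗ[B] M).comp φ ∧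
    (∀ j, φ.comp (eta j : (M ⊗[B] ExteriorAlgebra B (Fin n → B)) →ₗ[B] _) =
      (h j : M →ₗ[B] M).comp φ) := by
  have hφ' : ∀ (l : List (Fin n)) (x : M),
      φ (x ⊗ₜ[B] (l.map fun i => ExteriorAlgebra.ι B (Pi.single i (1 : B))).prod) =
        (l.map h).prod x := by
    intro l x
    have := hφ l.length l.get x
    simpa only [List.get_eq_getElem, List.ofFn_getElem_eq_map l h,
      List.ofFn_getElem_eq_map l fun i => ExteriorAlgebra.ι B (Pi.single i (1 : B))] using this
  have hdel' : ∀ (l : List (Fin n)) (x : M),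
      del (x ⊗ₜ[B] (l.map fun i => ExteriorAlgebra.ι B (Pi.single i (1 : B))).prod) =
        ((-1 : B) ^ l.length) •
          (d x ⊗ₜ[B] (l.map fun i => ExteriorAlgebra.ι B (Pi.single i (1 : B))).prod)
        + ∑ j : Fin l.length, ((-1 : B) ^ (j : ℕ) * f (l.get j)) •
            (x ⊗ₜ[B] ((l.eraseIdx j).map fun i =>
              ExteriorAlgebra.ι B (Pi.single i (1 : B))).prod) := by
    intro l x
    have := hdel l.length l.get x
    simpa only [List.get_eq_getElem, List.eraseIdx_map,
      List.ofFn_getElem_eq_map l fun i => ExteriorAlgebra.ι B (Pi.single i (1 : B))] using this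
  refine ⟨ExteriorAlgebra.tensor_hom_ext fun l x => ?_,
    fun j => ExteriorAlgebra.tensor_hom_ext fun l x => ?_⟩
  · have := LinearMap.congr_fun (Module.End.mul_list_prod_homotopy f d h hdh l) x
    simp only [LinearMap.comp_apply, hdel', hφ', map_add, map_sum, map_smul]
    simpa using this.symm
  · have := hφ' (j :: l) x
    rw [List.map_cons, List.prod_cons, List.map_cons, List.prod_cons] at this
    rw [LinearMap.comp_apply, LinearMap.comp_apply, heta, this, hφ', Module.End.mul_apply]
end

section
/- Let B be a commutative ring, f ∈ B, and let E, F be B-modules with B-linear maps p : E → F and q : F → E satisfying q∘p = f·id_E and p∘q = f·id_F. Consider the two K(B,f)-dg modules (for n = 1): M, the two-term complex F →^{q} E placed in two consecutive degrees with degree −1 operator given by p : E → F; and N, the three-term complex F →^{(−f,q)} F⊕E →^{(1,p)} F placed in three consecutive degrees (first map y ↦ (−f·y, q(y)), second map (y,x) ↦ y + p(x)) with degree −1 operators given by (y,x) ↦ −y from F⊕E to F and y ↦ (0, q(y)) from the top copy of F to F⊕E. Then the map α : M → N with components id_F : F → F and x ↦ (−p(x), x) : E → F⊕E is a morphism of K(B,f)-dg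 modules and a quasi-isomorphism (it induces isomorphisms on all cohomology modules). -/
/-- Let `p : E → F`, `q : F → E` with `q∘p = f·id` and `p∘q = f·id`.
Consider the `K(B,f)`-dg modules `M = (F →q E)` (two consecutive degrees, degree `−1`
operator `p`) and `N = (F →(−f,q) F⊕E →(1,p) F)` (three consecutive degrees, degree `−1`
operators `(y,x) ↦ −y` and `y ↦ (0, q y)`).  The map `α : M → N` with components
`id_F` and `x ↦ (−p x, x)` is a morphism of `K(B,f)`-dg modules and a quasi-isomorphism
(it induces isomorphisms on all cohomology modules). -/
theorem twoTerm_to_threeTerm_quasiIso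
    {B F E : Type*} [CommRing B]
    [AddCommGroup F] [Module B F] [AddCommGroup E] [Module B E]
    (f : B) (p : E →ₗ[B] F) (q : F →ₗ[B] E)
    (hqp : q.comp p = f • LinearMap.id) (hpq : p.comp q = f • LinearMap.id)
    -- the complex `N` and its degree `−1` operators
    (dN0 : F →ₗ[B] F × E) (dN1 : F × E →ₗ[B] F)
    (hdN0 : ∀ y : F, dN0 y = (-(f • y), q y))
    (hdN1 : ∀ z : F × E, dN1 z = z.1 + p z.2)
    (hN0 : F × E →ₗ[B] F) (hN1 : F →ₗ[B] F × E)
    (hhN0 : ∀ z : F × E, hN0 z = -z.1)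
    (hhN1 : ∀ y : F, hN1 y = (0, q y))
    -- the morphism `α`
    (α0 : F →ₗ[B] F) (α1 : E →ₗ[B] F × E)
    (hα0 : ∀ y : F, α0 y = y) (hα1 : ∀ x : E, α1 x = (-(p x), x)) :
    -- `α` is a morphism of `K(B,f)`-dg modules
    (dN0.comp α0 = α1.comp q) ∧ (dN1.comp α1 = 0) ∧ (α0.comp p = hN0.comp α1) ∧
    -- `α` is a quasi-isomorphism: iso on `H⁰` (kernels, via `α0 = id`) …
    (LinearMap.ker q = LinearMap.ker dN0) ∧
    -- … iso on `H¹`: the induced map `E/im q → (F⊕E)/im dN0` is injective and its range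
    -- is the kernel of the map induced by `dN1` …
    (Function.Injective
      (Submodule.mapQ (LinearMap.range q) (LinearMap.range dN0) α1
        (by
          rintro z ⟨y, rfl⟩
          refine Submodule.mem_comap.mpr ⟨y, ?_⟩
          have h1 : p (q y) = f • y := by
            have := congrArg (fun t => t y) hpq
            simpa using this
          rw [hα1, h1, hdN0]))) ∧
    (LinearMap.range
      (Submodule.mapQ (LinearMap.range q) (LinearMap.range dN0) α1
        (by
          rintro z ⟨y, rfl⟩
          refine Submodule.mem_comap.mpr ⟨y, ?_⟩
          have h1 : p (q y) = f • y := by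
            have := congrArg (fun t => t y) hpq
            simpa using this
          rw [hα1, h1, hdN0])) =
      LinearMap.ker
        (Submodule.liftQ (LinearMap.range dN0) dN1
          (by
            rintro z ⟨y, rfl⟩
            have h1 : p (q y) = f • y := by
              have := congrArg (fun t => t y) hpq
              simpa using this
            simp [LinearMap.mem_ker, hdN0, hdN1, h1]))) ∧
    -- … and iso on `H²`: the top cohomology of `N` vanishes.
    (LinearMap.range dN1 = ⊤) := by
  have hpq' (y : F) : p (q y) = f • y := by simpa using LinearMap.congr_fun hpq y
  refine ⟨?_, ?_, ?_, ?_, ?_, ?_, ?_⟩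
  · refine LinearMap.ext fun y => ?_
    simp only [LinearMap.comp_apply, hα0, hα1, hdN0, hpq']
  · refine LinearMap.ext fun x => ?_
    simp only [LinearMap.comp_apply, hα1, hdN1, neg_add_cancel, LinearMap.zero_apply]
  · refine LinearMap.ext fun x => ?_
    simp only [LinearMap.comp_apply, hα0, hα1, hhN0, neg_neg]
  · ext y
    simp only [LinearMap.mem_ker, hdN0, Prod.mk_eq_zero, neg_eq_zero]
    exact ⟨fun hy => ⟨by rw [← hpq', hy, map_zero], hy⟩, fun hy => hy.2⟩
  · rw [injective_iff_map_eq_zero]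
    intro a ha
    obtain ⟨x, rfl⟩ := Submodule.mkQ_surjective _ a
    rw [Submodule.mkQ_apply, Submodule.mapQ_apply, Submodule.Quotient.mk_eq_zero] at ha
    rw [Submodule.mkQ_apply, Submodule.Quotient.mk_eq_zero]
    obtain ⟨y, hy⟩ := ha
    rw [hdN0, hα1] at hy
    exact ⟨y, (Prod.ext_iff.mp hy).2⟩
  · ext a
    obtain ⟨⟨y, x⟩, rfl⟩ := Submodule.mkQ_surjective _ a
    rw [LinearMap.mem_ker, Submodule.mkQ_apply, Submodule.liftQ_apply, hdN1]
    constructor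
    · rintro ⟨b, hb⟩
      obtain ⟨x', rfl⟩ := Submodule.mkQ_surjective _ b
      rw [Submodule.mkQ_apply, Submodule.mapQ_apply, Submodule.Quotient.eq] at hb
      obtain ⟨w, hw⟩ := hb
      rw [hdN0, hα1, Prod.ext_iff] at hw
      obtain ⟨h₁, h₂⟩ := hw
      simp only [Prod.fst_sub, Prod.snd_sub] at h₁ h₂
      have h₃ := hpq' w
      rw [h₂, map_sub] at h₃
      rw [← h₃] at h₁
      rw [neg_sub, sub_eq_neg_add, sub_eq_add_neg, add_right_inj] at h₁
      rw [h₁, add_neg_cancel]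
    · intro h
      have h' : y = -p x := eq_neg_of_add_eq_zero_left h
      refine ⟨Submodule.Quotient.mk x, ?_⟩
      rw [Submodule.mapQ_apply, hα1, h']
  · rw [LinearMap.range_eq_top]
    exact fun y => ⟨(y, 0), by simp [hdN1]⟩
end

section
/- Let B be a commutative ring, f ∈ B, and let (E,d,h) be a K(B,f)-dg module (n = 1) such that E_m = 0 for all but finitely many m ∈ ℤ. Set X₁ = ⊕_{i∈ℤ} E_{2i−1} and X₀ = ⊕_{i∈ℤ} E_{2i}, and let δ₁ : X₁ → X₀ and δ₀ : X₀ → X₁ be the B-linear maps whose restriction to each summand E_m is d_m + h_m (where d_m : E_m → E_{m+1} and h_m : E_m → E_{m−1}). Then δ₀∘δ₁ = f·id_{X₁} and δ₁∘δ₀ = f·id_{X₀}. In particular, if each E_m is a finitely generated projective B-module, then (X₁, X₀, δ₁, δ₀) is a matrix factorization of (B,f). -/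
/-- Transport along an equality of degrees. -/
def castE {B : Type*} [CommRing B] (E : ℤ → Type*) [∀ m, AddCommGroup (E m)]
    [∀ m, Module B (E m)] {a b : ℤ} (hab : a = b) : E a ≃ₗ[B] E b := by
  subst hab; exact LinearEquiv.refl B (E a)

/-- The map `δ₁ : ⊕ᵢ E_{2i−1} → ⊕ᵢ E_{2i}` whose restriction to the summand `E_m`
(`m` odd) is `d_m + h_m`. -/
noncomputable def oddToEven {B : Type*} [CommRing B] (E : ℤ → Type*)
    [∀ m, AddCommGroup (E m)] [∀ m, Module B (E m)]
    (d : ∀ m : ℤ, E m →ₗ[B] E (m + 1)) (h : ∀ m : ℤ, E (m + 1) →ₗ[B] E m) :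
    (DirectSum ℤ fun i => E (2 * i - 1)) →ₗ[B] (DirectSum ℤ fun i => E (2 * i)) :=
  DirectSum.toModule B ℤ _ fun i =>
    ((DirectSum.lof B ℤ (fun j => E (2 * j)) i).comp
      ((castE E (show 2 * i - 1 + 1 = 2 * i by ring)).toLinearMap.comp (d (2 * i - 1))))
    + ((DirectSum.lof B ℤ (fun j => E (2 * j)) (i - 1)).comp
      ((castE E (show 2 * i - 2 = 2 * (i - 1) by ring)).toLinearMap.comp
        ((h (2 * i - 2)).comp
          (castE E (show 2 * i - 1 = 2 * i - 2 + 1 by ring)).toLinearMap)))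

/-- The map `δ₀ : ⊕ᵢ E_{2i} → ⊕ᵢ E_{2i−1}` whose restriction to the summand `E_m`
(`m` even) is `d_m + h_m`. -/
noncomputable def evenToOdd {B : Type*} [CommRing B] (E : ℤ → Type*)
    [∀ m, AddCommGroup (E m)] [∀ m, Module B (E m)]
    (d : ∀ m : ℤ, E m →ₗ[B] E (m + 1)) (h : ∀ m : ℤ, E (m + 1) →ₗ[B] E m) :
    (DirectSum ℤ fun i => E (2 * i)) →ₗ[B] (DirectSum ℤ fun i => E (2 * i - 1)) :=
  DirectSum.toModule B ℤ _ fun i =>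
    ((DirectSum.lof B ℤ (fun j => E (2 * j - 1)) (i + 1)).comp
      ((castE E (show 2 * i + 1 = 2 * (i + 1) - 1 by ring)).toLinearMap.comp (d (2 * i))))
    + ((DirectSum.lof B ℤ (fun j => E (2 * j - 1)) i).comp
      ((h (2 * i - 1)).comp
        (castE E (show 2 * i = 2 * i - 1 + 1 by ring)).toLinearMap))

/-- The differential of `E`, with target in any degree equal to `a + 1`. -/
def raise {B : Type*} [CommRing B] (E : ℤ → Type*) [∀ m, AddCommGroup (E m)]
    [∀ m, Module B (E m)] (d : ∀ m : ℤ, E m →ₗ[B] E (m + 1)) {a b : ℤ} (hab : a + 1 = b) :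
    E a →ₗ[B] E b :=
  (castE E hab).toLinearMap.comp (d a)

/-- The homotopy of `E`, with source in any degree equal to `a + 1`. -/
def lower {B : Type*} [CommRing B] (E : ℤ → Type*) [∀ m, AddCommGroup (E m)]
    [∀ m, Module B (E m)] (h : ∀ m : ℤ, E (m + 1) →ₗ[B] E m) {a b : ℤ} (hab : a + 1 = b) :
    E b →ₗ[B] E a :=
  (h a).comp (castE E hab.symm).toLinearMap

section Folding

variable {B : Type*} [CommRing B] (E : ℤ → Type*) [∀ m, AddCommGroup (E m)]
  [∀ m, Module B (E m)]

lemma raise_raise {d : ∀ m : ℤ, E m →ₗ[B] E (m + 1)}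
    (hd : ∀ m, (d (m + 1)).comp (d m) = 0) {a b c : ℤ} (hab : a + 1 = b) (hbc : b + 1 = c)
    (x : E a) : raise E d hbc (raise E d hab x) = 0 := by
  subst hab hbc
  exact LinearMap.congr_fun (hd a) x

lemma lower_lower {h : ∀ m : ℤ, E (m + 1) →ₗ[B] E m}
    (hhsq : ∀ m, (h m).comp (h (m + 1)) = 0) {a b c : ℤ} (hab : a + 1 = b) (hbc : b + 1 = c)
    (x : E c) : lower E h hab (lower E h hbc x) = 0 := by
  subst hab hbc
  exact LinearMap.congr_fun (hhsq a) x

lemma raise_lower_add_lower_raise {f : B} {d : ∀ m : ℤ, E m →ₗ[B] E (m + 1)}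
    {h : ∀ m : ℤ, E (m + 1) →ₗ[B] E m}
    (hdh : ∀ m, (d m).comp (h m) + (h (m + 1)).comp (d (m + 1)) = f • LinearMap.id)
    {a b c : ℤ} (hab : a + 1 = b) (hbc : b + 1 = c) (x : E b) :
    raise E d hab (lower E h hab x) + lower E h hbc (raise E d hbc x) = f • x := by
  subst hab hbc
  exact LinearMap.congr_fun (hdh a) x

lemma castE_homotopy_castE (h : ∀ m : ℤ, E (m + 1) →ₗ[B] E m) {a b c : ℤ} (hac : a = c)
    (hba : b = a + 1) (hcb : c + 1 = b) (x : E b) :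
    castE (B := B) E hac (h a (castE (B := B) E hba x)) = lower E h hcb x := by
  subst hac hba
  rfl

lemma lof_raise (d : ∀ m : ℤ, E m →ₗ[B] E (m + 1)) (g : ℤ → ℤ) {i j a : ℤ} (hij : i = j)
    (hi : a + 1 = g i) (hj : a + 1 = g j) (x : E a) :
    DirectSum.lof B ℤ (fun k => E (g k)) i (raise E d hi x) =
      DirectSum.lof B ℤ (fun k => E (g k)) j (raise E d hj x) := by
  subst hij
  rfl

lemma lof_lower (h : ∀ m : ℤ, E (m + 1) →ₗ[B] E m) (g : ℤ → ℤ) {i j a : ℤ} (hij : i = j)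
    (hi : g i + 1 = a) (hj : g j + 1 = a) (x : E a) :
    DirectSum.lof B ℤ (fun k => E (g k)) i (lower E h hi x) =
      DirectSum.lof B ℤ (fun k => E (g k)) j (lower E h hj x) := by
  subst hij
  rfl

lemma oddToEven_lof (d : ∀ m : ℤ, E m →ₗ[B] E (m + 1)) (h : ∀ m : ℤ, E (m + 1) →ₗ[B] E m)
    (i : ℤ) (x : E (2 * i - 1)) :
    oddToEven E d h (DirectSum.lof B ℤ (fun j => E (2 * j - 1)) i x) =
      DirectSum.lof B ℤ (fun j => E (2 * j)) i
        (raise E d (show 2 * i - 1 + 1 = 2 * i by ring) x) +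
      DirectSum.lof B ℤ (fun j => E (2 * j)) (i - 1)
        (lower E h (show 2 * (i - 1) + 1 = 2 * i - 1 by ring) x) := by
  rw [oddToEven, DirectSum.toModule_lof, LinearMap.add_apply]
  exact congrArg (_ + DirectSum.lof B ℤ (fun j => E (2 * j)) (i - 1) ·)
    (castE_homotopy_castE E h _ _ _ x)

lemma evenToOdd_lof (d : ∀ m : ℤ, E m →ₗ[B] E (m + 1)) (h : ∀ m : ℤ, E (m + 1) →ₗ[B] E m)
    (i : ℤ) (x : E (2 * i)) :
    evenToOdd E d h (DirectSum.lof B ℤ (fun j => E (2 * j)) i x) =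
      DirectSum.lof B ℤ (fun j => E (2 * j - 1)) (i + 1)
        (raise E d (show 2 * i + 1 = 2 * (i + 1) - 1 by ring) x) +
      DirectSum.lof B ℤ (fun j => E (2 * j - 1)) i
        (lower E h (show 2 * i - 1 + 1 = 2 * i by ring) x) := by
  rw [evenToOdd, DirectSum.toModule_lof, LinearMap.add_apply]
  rfl

end Folding

/-- A direct sum of finite modules, all but finitely many of which vanish, is finite. -/
lemma finite_directSum_of_finset {R ι : Type*} [CommRing R] [DecidableEq ι] (M : ι → Type*)
    [∀ i, AddCommGroup (M i)] [∀ i, Module R (M i)] [∀ i, Module.Finite R (M i)]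
    (T : Finset ι) (hT : ∀ i ∉ T, ∀ x : M i, x = 0) :
    Module.Finite R (DirectSum ι M) := by
  refine Module.Finite.of_surjective
    (∑ i : T, (DirectSum.lof R ι M i).comp (LinearMap.proj i) :
      (∀ i : T, M i) →ₗ[R] DirectSum ι M) fun y => ⟨fun i => y i, ?_⟩
  ext j
  by_cases hj : j ∈ T
  · simp only [LinearMap.sum_apply, LinearMap.comp_apply, LinearMap.proj_apply]
    rw [Finset.sum_coe_sort T fun i => DirectSum.lof R ι M i (y i)]
    rw [DFinsupp.finsetSum_apply, Finset.sum_eq_single j]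
    · exact DirectSum.of_eq_same _ _
    · intro i _ hij
      exact DirectSum.of_eq_of_ne _ _ _ hij.symm
    · exact fun hn => absurd hj hn
  · rw [hT j hj (y j)]
    exact hT j hj _

/-- Let `(E,d,h)` be a `K(B,f)`-dg module (`n = 1`) with `E_m = 0` for
all but finitely many `m`.  With `X₁ = ⊕ᵢ E_{2i−1}`, `X₀ = ⊕ᵢ E_{2i}` and
`δ₁ : X₁ → X₀`, `δ₀ : X₀ → X₁` given on each summand `E_m` by `d_m + h_m`, one has
`δ₀∘δ₁ = f·id` and `δ₁∘δ₀ = f·id`.  In particular, if each `E_m` is finitely generated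
projective, `(X₁, X₀, δ₁, δ₀)` is a matrix factorization of `(B,f)`. -/
theorem folding_is_matrixFactorization
    {B : Type*} [CommRing B] (f : B) (E : ℤ → Type*)
    [∀ m, AddCommGroup (E m)] [∀ m, Module B (E m)]
    (d : ∀ m : ℤ, E m →ₗ[B] E (m + 1)) (h : ∀ m : ℤ, E (m + 1) →ₗ[B] E m)
    (hd : ∀ m, (d (m + 1)).comp (d m) = 0)
    (hhsq : ∀ m, (h m).comp (h (m + 1)) = 0)
    (hdh : ∀ m, (d m).comp (h m) + (h (m + 1)).comp (d (m + 1)) = f • LinearMap.id)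
    (S : Finset ℤ) (hS : ∀ m ∉ S, ∀ x : E m, x = 0) :
    (evenToOdd E d h).comp (oddToEven E d h) = f • LinearMap.id ∧
    (oddToEven E d h).comp (evenToOdd E d h) = f • LinearMap.id ∧
    ((∀ m, Module.Finite B (E m)) → (∀ m, Module.Projective B (E m)) →
      Module.Finite B (DirectSum ℤ fun i => E (2 * i - 1)) ∧
      Module.Projective B (DirectSum ℤ fun i => E (2 * i - 1)) ∧
      Module.Finite B (DirectSum ℤ fun i => E (2 * i)) ∧
      Module.Projective B (DirectSum ℤ fun i => E (2 * i))) := by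
  refine ⟨?_, ?_, fun _ _ => ⟨?_, ?_, ?_, ?_⟩⟩
  · refine DirectSum.linearMap_ext B fun i => LinearMap.ext fun x => ?_
    simp only [LinearMap.comp_apply, LinearMap.smul_apply, LinearMap.id_apply]
    rw [oddToEven_lof, map_add, evenToOdd_lof, evenToOdd_lof, raise_raise E hd,
      lower_lower E hhsq, map_zero, map_zero, zero_add,
      add_zero (M := DirectSum ℤ fun j => E (2 * j - 1)),
      lof_raise E d (fun k => 2 * k - 1) (show i - 1 + 1 = i by ring) _ (by ring), ← map_add,
      add_comm, raise_lower_add_lower_raise E hdh, map_smul]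
  · refine DirectSum.linearMap_ext B fun i => LinearMap.ext fun x => ?_
    simp only [LinearMap.comp_apply, LinearMap.smul_apply, LinearMap.id_apply]
    rw [evenToOdd_lof, map_add, oddToEven_lof, oddToEven_lof, raise_raise E hd,
      lower_lower E hhsq, map_zero, map_zero, zero_add, add_zero (M := DirectSum ℤ fun j => E (2 * j)),
      lof_lower E h (fun k => 2 * k) (show i + 1 - 1 = i by ring) _ (by ring), ← map_add,
      add_comm, raise_lower_add_lower_raise E hdh, map_smul]
  · refine finite_directSum_of_finset _ (S.preimage (fun i => 2 * i - 1) ?_) ?_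
    · intro a _ b _ hab
      simp only at hab
      omega
    · exact fun i hi => hS _ fun hm => hi (Finset.mem_preimage.mpr hm)
  · exact inferInstance
  · refine finite_directSum_of_finset _ (S.preimage (fun i => 2 * i) ?_) ?_
    · intro a _ b _ hab
      simp only at hab
      omega
    · exact fun i hi => hS _ fun hm => hi (Finset.mem_preimage.mpr hm)
  · exact inferInstance
end

section
/- Let B be a commutative ring and f ∈ B. Let (E,d,h) and (E′,d′,h′) be K(B,f)-dg modules (n = 1) concentrated in degrees −1 and 0, so d : E_{−1} → E₀ and h : E₀ → E_{−1} satisfy d∘h = f·id_{E₀} and h∘d = f·id_{E_{−1}} (and similarly for the primed data), and let φ = (φ_{−1}, φ₀) be a morphism of K(B,f)-dg modules from (E,d,h) to (E′,d′,h′). Then the B-linear maps A = [[d′, φ₀],[0, −h]] : E′_{−1}⊕E₀ → E′₀⊕E_{−1} and C = [[h′, φ_{−1}],[0, −d]] : E′₀⊕E_{−1} → E′_{−1}⊕E₀ satisfy C∘A = f·id_{E′_{−1}⊕E₀} and A∘C = f·id_{E′₀⊕E_{−1}}. In particular, if all four modules are finitely generated projective, (E′_{−1}⊕E₀, E′₀⊕E_{−1},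 A, C) is a matrix factorization of (B,f). -/
/-- Let `(E,d,h)` and `(E′,d′,h′)` be `K(B,f)`-dg modules concentrated in
degrees `−1` and `0`, and let `φ = (φ₋₁, φ₀)` be a morphism between them.  Then the maps
`A = [[d′, φ₀],[0, −h]] : E′₋₁⊕E₀ → E′₀⊕E₋₁` and `C = [[h′, φ₋₁],[0, −d]] : E′₀⊕E₋₁ → E′₋₁⊕E₀`
satisfy `C∘A = f·id` and `A∘C = f·id`; in particular, if all four modules are finitely
generated projective, `(E′₋₁⊕E₀, E′₀⊕E₋₁, A, C)` is a matrix factorization of `(B,f)`. -/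
theorem cone_of_twoTerm_is_matrixFactorization
    {B Em1 E0 Em1' E0' : Type*} [CommRing B]
    [AddCommGroup Em1] [Module B Em1] [AddCommGroup E0] [Module B E0]
    [AddCommGroup Em1'] [Module B Em1'] [AddCommGroup E0'] [Module B E0']
    (f : B)
    (d : Em1 →ₗ[B] E0) (h : E0 →ₗ[B] Em1)
    (d' : Em1' →ₗ[B] E0') (h' : E0' →ₗ[B] Em1')
    (hdh : d.comp h = f • LinearMap.id) (hhd : h.comp d = f • LinearMap.id)
    (hdh' : d'.comp h' = f • LinearMap.id) (hhd' : h'.comp d' = f • LinearMap.id)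
    (φm : Em1 →ₗ[B] Em1') (φ0 : E0 →ₗ[B] E0')
    (hφd : φ0.comp d = d'.comp φm) (hφh : φm.comp h = h'.comp φ0)
    (A : Em1' × E0 →ₗ[B] E0' × Em1) (C : E0' × Em1 →ₗ[B] Em1' × E0)
    (hA : ∀ (y : Em1') (x : E0), A (y, x) = (d' y + φ0 x, -(h x)))
    (hC : ∀ (z : E0') (w : Em1), C (z, w) = (h' z + φm w, -(d w))) :
    C.comp A = f • LinearMap.id ∧ A.comp C = f • LinearMap.id ∧
      (Module.Finite B Em1 → Module.Finite B E0 → Module.Finite B Em1' →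
        Module.Finite B E0' → Module.Projective B Em1 → Module.Projective B E0 →
        Module.Projective B Em1' → Module.Projective B E0' →
        (Module.Finite B (Em1' × E0) ∧ Module.Projective B (Em1' × E0) ∧
          Module.Finite B (E0' × Em1) ∧ Module.Projective B (E0' × Em1))) := by
  refine ⟨?_, ?_, ?_⟩
  · refine LinearMap.ext fun ⟨y, x⟩ => ?_
    have e₁ : h' (d' y) = f • y := LinearMap.congr_fun hhd' y
    have e₂ : d (h x) = f • x := LinearMap.congr_fun hdh x
    have e₃ : φm (h x) = h' (φ0 x) := LinearMap.congr_fun hφh x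
    simp [hA, hC, e₁, e₂, e₃]
  · refine LinearMap.ext fun ⟨z, w⟩ => ?_
    have e₁ : d' (h' z) = f • z := LinearMap.congr_fun hdh' z
    have e₂ : h (d w) = f • w := LinearMap.congr_fun hhd w
    have e₃ : φ0 (d w) = d' (φm w) := LinearMap.congr_fun hφd w
    simp [hA, hC, e₁, e₂, e₃]
  · intro _ _ _ _ _ _ _ _
    exact ⟨inferInstance, inferInstance, inferInstance, inferInstance⟩
end

section
/- Let (E,d,h₁,…,hₙ) be a K(B,f̲)-dg module with E_s = 0 for s < m′ and for s > m. Let φ : (E,d)⊗_B K(B,f̲) → E be the canonical morphism x⊗ε_{i₁}∧⋯∧ε_{i_k} ↦ h_{i₁}∘⋯∘h_{i_k}(x), and let C be its cone, with C_s = E_s ⊕ ⊕_{k=0}^{n} E_{s+1+k}⊗_B Λᵏ(Bⁿ), differential D with components (−∂, 0; φ, d) and degree −1 operators Hᵢ with components (−ηⁱ, 0; 0, hᵢ). Define the graded B-submodule F ⊆ C by F_s = E_s ⊕ ⊕_{0≤k≤n, k+s≥m′+n} E_{s+1+k}⊗_B Λᵏ(Bⁿ). Then F is stable under the structure maps of C,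 i.e. D(F_s) ⊆ F_{s+1} and Hᵢ(F_s) ⊆ F_{s−1} for all s and all i = 1,…,n; moreover F_s = 0 for s ≤ m′−1 and F_s = C_s for s ≥ m′+n. In particular (F, D|_F, H₁|_F,…,Hₙ|_F) is a K(B,f̲)-dg module concentrated in degrees [m′, m]. -/
open TensorProduct

/-- The wedge `v₁ ∧ ⋯ ∧ v_k` as an element of the `k`-th exterior power. -/
noncomputable def wedge (B : Type*) [CommRing B] {M : Type*} [AddCommGroup M] [Module B M]
    (k : ℕ) (v : Fin k → M) : ⋀[B]^k M :=
  ⟨ExteriorAlgebra.ιMulti B k v, ExteriorAlgebra.ιMulti_range B k (Set.mem_range_self v)⟩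

/-- The composite `h_{i₁} ∘ ⋯ ∘ h_{i_k} : E_{u+k} → E_u` of the degree `−1` operators of a
`K(B,f̲)`-dg module. -/
noncomputable def hcomp {B : Type*} [CommRing B] {n : ℕ} {E : ℤ → Type*}
    [∀ m, AddCommGroup (E m)] [∀ m, Module B (E m)]
    (h : Fin n → ∀ m : ℤ, E (m + 1) →ₗ[B] E m) :
    (k : ℕ) → (Fin k → Fin n) → (u : ℤ) → (E (u + (k : ℤ)) →ₗ[B] E u)
  | 0, _, u => (castE (B := B) E (by push_cast; ring)).toLinearMap
  | (k + 1), ι, u =>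
      (h (ι 0) u).comp ((hcomp h k (fun j => ι j.succ) (u + 1)).comp
        (castE (B := B) E (by push_cast; ring)).toLinearMap)

/-- The degree `u` part of the tensor product `(E,d) ⊗_B K(B,f̲)`:
`⊕_k E_{u+k} ⊗_B Λᵏ(Bⁿ)` (the summands with `k > n` vanish). -/
abbrev KTensor (B : Type*) [CommRing B] (n : ℕ) (E : ℤ → Type*)
    [∀ m, AddCommGroup (E m)] [∀ m, Module B (E m)] (u : ℤ) : Type _ :=
  DirectSum ℕ fun k => (E (u + (k : ℤ))) ⊗[B] (⋀[B]^k (Fin n → B))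

/-- The graded submodule `F` of the cone `C`, with
`F_s = E_s ⊕ ⊕_{k + s ≥ m′ + n} E_{s+1+k} ⊗_B Λᵏ(Bⁿ)`. -/
noncomputable def Fsub (B : Type*) [CommRing B] (n : ℕ) (E : ℤ → Type*)
    [∀ m, AddCommGroup (E m)] [∀ m, Module B (E m)] (m' : ℤ) (s : ℤ) :
    Submodule B (KTensor B n E (s + 1) × E s) :=
  Submodule.prod
    (⨅ (k : ℕ) (_ : (k : ℤ) + s < m' + n),
      LinearMap.ker (DirectSum.component B ℕ
        (fun k' => (E (s + 1 + (k' : ℤ))) ⊗[B] (⋀[B]^k' (Fin n → B))) k))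
    ⊤

/-- A linear map out of a direct sum kills `t` as soon as, for every index, it kills the
summand or the component of `t` vanishes. -/
theorem DirectSum.map_eq_zero_of_component {B ι X : Type*} [CommRing B] [DecidableEq ι]
    {M : ι → Type*} [∀ i, AddCommGroup (M i)] [∀ i, Module B (M i)]
    [AddCommGroup X] [Module B X] (g : (DirectSum ι M) →ₗ[B] X) (t : DirectSum ι M)
    (hg : ∀ k, DirectSum.component B ι M k t = 0 ∨ g ∘ₗ DirectSum.lof B ι M k = 0) :
    g t = 0 := by
  classical
  rw [← DirectSum.sum_support_of t, map_sum]
  refine Finset.sum_eq_zero fun k _ => ?_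
  rcases hg k with hk | hk
  · rw [show t k = 0 from hk, map_zero, map_zero]
  · exact LinearMap.congr_fun hk (t k)

/-- A component of an element of another summand vanishes. -/
theorem DirectSum.component_lof_of_ne {B ι : Type*} [CommRing B] [DecidableEq ι]
    {M : ι → Type*} [∀ i, AddCommGroup (M i)] [∀ i, Module B (M i)] {i j : ι} (hij : j ≠ i)
    (b : M j) : DirectSum.component B ι M i (DirectSum.lof B ι M j b) = 0 := by
  rw [DirectSum.component.of, dif_neg hij]

/-- Linear maps out of `Λᵏ(Bⁿ)` agree if they agree on wedges of distinct basis vectors. -/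
theorem exteriorPower_hom_ext {B : Type*} [CommRing B] {n k : ℕ} {X : Type*}
    [AddCommGroup X] [Module B X] {g g' : ⋀[B]^k (Fin n → B) →ₗ[B] X}
    (hg : ∀ ι : Fin k → Fin n, Function.Injective ι →
      g (wedge B k fun j => Pi.single (ι j) (1 : B)) =
        g' (wedge B k fun j => Pi.single (ι j) (1 : B))) : g = g' := by
  refine exteriorPower.linearMap_ext ((Pi.basisFun B (Fin n)).ext_alternating fun ι hι => ?_)
  simp only [Pi.basisFun_apply]
  exact hg ι hι

/-- `Λᵏ(Bⁿ)` vanishes for `k > n`. -/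
theorem exteriorPower_subsingleton {B : Type*} [CommRing B] {n k : ℕ} (hk : n < k) :
    Subsingleton (⋀[B]^k (Fin n → B)) := by
  have hid : (LinearMap.id : ⋀[B]^k (Fin n → B) →ₗ[B] _) = 0 :=
    exteriorPower_hom_ext fun ι hι => by
      have := Fintype.card_le_of_injective ι hι
      simp only [Fintype.card_fin] at this
      omega
  exact subsingleton_of_forall_eq 0 fun x => LinearMap.congr_fun hid x

/-- A linear map out of `Y ⊗ Λᵏ(Bⁿ)` vanishes if it vanishes on the generators
`x ⊗ (ε_{i₁} ∧ ⋯ ∧ ε_{i_k})`. -/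
theorem tensor_exteriorPower_hom_eq_zero {B : Type*} [CommRing B] {n k : ℕ} {X Y : Type*}
    [AddCommGroup X] [Module B X] [AddCommGroup Y] [Module B Y]
    {g : Y ⊗[B] (⋀[B]^k (Fin n → B)) →ₗ[B] X}
    (hg : ∀ (x : Y) (ι : Fin k → Fin n),
      g (x ⊗ₜ[B] wedge B k fun j => Pi.single (ι j) (1 : B)) = 0) : g = 0 := by
  refine TensorProduct.ext (LinearMap.ext fun x => exteriorPower_hom_ext fun ι _ => ?_)
  exact hg x ι

theorem mem_Fsub {B : Type*} [CommRing B] {n : ℕ} {E : ℤ → Type*}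
    [∀ m, AddCommGroup (E m)] [∀ m, Module B (E m)] {m' s : ℤ}
    {p : KTensor B n E (s + 1) × E s} :
    p ∈ Fsub B n E m' s ↔ ∀ k : ℕ, (k : ℤ) + s < m' + n →
      DirectSum.component B ℕ
        (fun k' => (E (s + 1 + (k' : ℤ))) ⊗[B] (⋀[B]^k' (Fin n → B))) k p.1 = 0 := by
  simp [Fsub, Submodule.mem_prod]

/-- Let `(E,d,h₁,…,hₙ)` be a `K(B,f̲)`-dg module concentrated in degrees
`[m′, m]`, `φ : (E,d)⊗_B K(B,f̲) → E` the canonical morphism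
`x ⊗ ε_{i₁}∧⋯∧ε_{i_k} ↦ h_{i₁}∘⋯∘h_{i_k}(x)`, and `C` its cone, with
`C_s = E_s ⊕ ⊕_k E_{s+1+k}⊗Λᵏ`, differential `D = (−∂, 0; φ, d)` and degree `−1`
operators `Hᵢ = (−ηⁱ, 0; 0, hᵢ)`.  Then the graded submodule
`F_s = E_s ⊕ ⊕_{k+s ≥ m′+n} E_{s+1+k}⊗Λᵏ` is stable under the structure maps of `C`:
`D(F_s) ⊆ F_{s+1}` and `Hᵢ(F_s) ⊆ F_{s−1}`; moreover `F_s = 0` for `s ≤ m′−1` and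
`F_s = C_s` for `s ≥ m′+n`. -/
theorem cone_submodule_truncation
    {B : Type*} [CommRing B] {n : ℕ} (f : Fin n → B)
    (E : ℤ → Type*) [∀ m, AddCommGroup (E m)] [∀ m, Module B (E m)]
    (d : ∀ m : ℤ, E m →ₗ[B] E (m + 1))
    (h : Fin n → ∀ m : ℤ, E (m + 1) →ₗ[B] E m)
    (hdsq : ∀ m, (d (m + 1)).comp (d m) = 0)
    (hhsq : ∀ i m, (h i m).comp (h i (m + 1)) = 0)
    (hdh : ∀ i m, (d m).comp (h i m) + (h i (m + 1)).comp (d (m + 1)) = f i • LinearMap.id)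
    (hhh : ∀ i j m, (h i m).comp (h j (m + 1)) + (h j m).comp (h i (m + 1)) = 0)
    (m' m : ℤ) (hbound : ∀ s : ℤ, (s < m' ∨ m < s) → ∀ x : E s, x = 0)
    -- the differential `∂`, the operators `ηⁱ` and the canonical morphism `φ`
    -- on `(E,d) ⊗_B K(B,f̲)`, characterized on generators
    (del : ∀ u : ℤ, KTensor B n E u →ₗ[B] KTensor B n E (u + 1))
    (eta : Fin n → ∀ u : ℤ, KTensor B n E (u + 1) →ₗ[B] KTensor B n E u)
    (ph : ∀ u : ℤ, KTensor B n E u →ₗ[B] E u)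
    (hdel0 : ∀ (u : ℤ) (x : E (u + ((0 : ℕ) : ℤ))),
      del u (DirectSum.lof B ℕ
          (fun k' => (E (u + (k' : ℤ))) ⊗[B] (⋀[B]^k' (Fin n → B))) 0
          (x ⊗ₜ[B] wedge B 0 (fun j => j.elim0))) =
        DirectSum.lof B ℕ
          (fun k' => (E (u + 1 + (k' : ℤ))) ⊗[B] (⋀[B]^k' (Fin n → B))) 0
          ((castE (B := B) E (by push_cast; ring) (d (u + ((0 : ℕ) : ℤ)) x)) ⊗ₜ[B]
            wedge B 0 (fun j => j.elim0)))
    (hdel : ∀ (u : ℤ) (k : ℕ) (ι : Fin (k + 1) → Fin n) (x : E (u + ((k + 1 : ℕ) : ℤ))),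
      del u (DirectSum.lof B ℕ
          (fun k' => (E (u + (k' : ℤ))) ⊗[B] (⋀[B]^k' (Fin n → B))) (k + 1)
          (x ⊗ₜ[B] wedge B (k + 1) (fun j => Pi.single (ι j) (1 : B)))) =
        ((-1 : B) ^ (k + 1)) •
          DirectSum.lof B ℕ
            (fun k' => (E (u + 1 + (k' : ℤ))) ⊗[B] (⋀[B]^k' (Fin n → B))) (k + 1)
            ((castE (B := B) E (by push_cast; ring) (d (u + ((k + 1 : ℕ) : ℤ)) x)) ⊗ₜ[B]
              wedge B (k + 1) (fun j => Pi.single (ι j) (1 : B)))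
        + ∑ j : Fin (k + 1), ((-1 : B) ^ (j : ℕ) * f (ι j)) •
            DirectSum.lof B ℕ
              (fun k' => (E (u + 1 + (k' : ℤ))) ⊗[B] (⋀[B]^k' (Fin n → B))) k
              ((castE (B := B) E (by push_cast; ring) x) ⊗ₜ[B]
                wedge B k (fun l => Pi.single (ι (j.succAbove l)) (1 : B))))
    (heta : ∀ (i : Fin n) (u : ℤ) (k : ℕ) (x : E (u + 1 + (k : ℤ)))
        (v : Fin k → (Fin n → B)),
      eta i u (DirectSum.lof B ℕ
          (fun k' => (E (u + 1 + (k' : ℤ))) ⊗[B] (⋀[B]^k' (Fin n → B))) k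
          (x ⊗ₜ[B] wedge B k v)) =
        DirectSum.lof B ℕ
          (fun k' => (E (u + (k' : ℤ))) ⊗[B] (⋀[B]^k' (Fin n → B))) (k + 1)
          ((castE (B := B) E (by push_cast; ring) x) ⊗ₜ[B]
            wedge B (k + 1) (Fin.cons (Pi.single i (1 : B)) v)))
    (hph : ∀ (u : ℤ) (k : ℕ) (ι : Fin k → Fin n) (x : E (u + (k : ℤ))),
      ph u (DirectSum.lof B ℕ
          (fun k' => (E (u + (k' : ℤ))) ⊗[B] (⋀[B]^k' (Fin n → B))) k
          (x ⊗ₜ[B] wedge B k (fun j => Pi.single (ι j) (1 : B)))) = hcomp h k ι u x)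
    -- the cone differential and its degree `−1` operators
    (D : ∀ s : ℤ, (KTensor B n E (s + 1) × E s) →ₗ[B]
        (KTensor B n E (s + 1 + 1) × E (s + 1)))
    (hD : ∀ (s : ℤ) (t : KTensor B n E (s + 1)) (x : E s),
      D s (t, x) = (-(del (s + 1) t), ph (s + 1) t + d s x))
    (H : Fin n → ∀ s : ℤ, (KTensor B n E (s + 1 + 1) × E (s + 1)) →ₗ[B]
        (KTensor B n E (s + 1) × E s))
    (hH : ∀ (i : Fin n) (s : ℤ) (t : KTensor B n E (s + 1 + 1)) (x : E (s + 1)),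
      H i s (t, x) = (-(eta i (s + 1) t), h i s x)) :
    (∀ s : ℤ, Submodule.map (D s) (Fsub B n E m' s) ≤ Fsub B n E m' (s + 1)) ∧
    (∀ (i : Fin n) (s : ℤ), Submodule.map (H i s) (Fsub B n E m' (s + 1)) ≤ Fsub B n E m' s) ∧
    (∀ s : ℤ, s ≤ m' - 1 → Fsub B n E m' s = ⊥) ∧
    (∀ s : ℤ, m' + (n : ℤ) ≤ s → Fsub B n E m' s = ⊤) := by
  refine ⟨fun s => ?_, fun i s => ?_, fun s hs => ?_, fun s hs => ?_⟩
  · rintro _ ⟨⟨t, x⟩, ht, rfl⟩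
    replace ht := mem_Fsub.1 ht
    refine mem_Fsub.2 fun j hj => ?_
    rw [hD, map_neg, neg_eq_zero]
    refine DirectSum.map_eq_zero_of_component (DirectSum.component B ℕ _ j ∘ₗ del (s + 1)) t
      fun k => ?_
    by_cases hk : (k : ℤ) + s < m' + n
    · exact Or.inl (ht k hk)
    · right
      refine tensor_exteriorPower_hom_eq_zero fun y ι => ?_
      simp only [LinearMap.comp_apply]
      cases k with
      | zero =>
        rw [Subsingleton.elim (fun j : Fin 0 => (Pi.single (ι j) 1 : Fin n → B))
          (fun j => j.elim0), hdel0, DirectSum.component_lof_of_ne (by omega)]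
      | succ k =>
        rw [hdel, map_add, map_smul, map_sum, DirectSum.component_lof_of_ne (by omega),
          smul_zero, zero_add]
        refine Finset.sum_eq_zero fun l _ => ?_
        rw [map_smul, DirectSum.component_lof_of_ne (by omega), smul_zero]
  · rintro _ ⟨⟨t, x⟩, ht, rfl⟩
    replace ht := mem_Fsub.1 ht
    refine mem_Fsub.2 fun j hj => ?_
    rw [hH, map_neg, neg_eq_zero]
    refine DirectSum.map_eq_zero_of_component (DirectSum.component B ℕ _ j ∘ₗ eta i (s + 1)) t
      fun k => ?_
    by_cases hk : (k : ℤ) + (s + 1) < m' + n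
    · exact Or.inl (ht k hk)
    · right
      refine tensor_exteriorPower_hom_eq_zero fun y ι => ?_
      simp only [LinearMap.comp_apply]
      rw [heta, DirectSum.component_lof_of_ne (by omega)]
  · refine (Submodule.eq_bot_iff _).2 ?_
    rintro ⟨t, x⟩ ht
    replace ht := mem_Fsub.1 ht
    refine Prod.ext (DFinsupp.ext fun k => ?_) (hbound s (Or.inl (by omega)) x)
    by_cases hk : (k : ℤ) + s < m' + n
    · exact ht k hk
    · have := exteriorPower_subsingleton (B := B) (n := n) (k := k) (by omega)
      exact Subsingleton.elim _ _
  · refine (Submodule.eq_top_iff').2 fun p => mem_Fsub.2 fun k hk => ?_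
    omega
end
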